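/- arXiv:1502.04929 — 4 statements merged into one kernel-verified Lean document; each statement's English description precedes it below -/
import Mathlib

section
/- For every z ∈ ℂ^n with Im z ≠ 0 and every v ∈ ℂ^n, the Laplacian at t = 0 of the function t ↦ ‖Im(z + t·v)‖ (t ranging over ℂ) is ≥ 0. That is, the function z ↦ ‖Im z‖ is plurisubharmonic on ℂ^n \ ℝ^n. -/
open Complex

/-- The componentwise imaginary part of a vector in `ℂ^n`, as a vector in `ℝ^n`. -/
noncomputable def imPart {n : ℕ} (z : EuclideanSpace ℂ (Fin n)) : EuclideanSpace ℝ (Fin n) :=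
  (WithLp.equiv 2 (Fin n → ℝ)).symm fun k => (z k).im

/-- The Laplacian of `g : ℂ → ℝ` at `t`, viewing `ℂ ≅ ℝ²`: the sum of the second
derivatives in the directions `1` and `I`. -/
noncomputable def lap (g : ℂ → ℝ) (t : ℂ) : ℝ :=
  iteratedFDeriv ℝ 2 g t ![1, 1] + iteratedFDeriv ℝ 2 g t ![Complex.I, Complex.I]

open Filter Topology in
/-- The second derivative of a convex function is nonnegative wherever the function is `C²`. -/
theorem ConvexOn.iteratedFDeriv_two_nonneg {E : Type*} [NormedAddCommGroup E] [NormedSpace ℝ E]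
    {f : E → ℝ} (hf : ConvexOn ℝ Set.univ f) {x : E} (hx : ContDiffAt ℝ 2 f x) (e : E) :
    0 ≤ iteratedFDeriv ℝ 2 f x ![e, e] := by
  rw [iteratedFDeriv_two_apply]
  simp only [Matrix.cons_val_zero, Matrix.cons_val_one]
  have hline (s : ℝ) : HasDerivAt (fun s : ℝ => x + s • e) e s := by
    simpa using ((hasDerivAt_id s).smul_const e).const_add x
  have htend : Tendsto (fun s : ℝ => x + s • e) (𝓝 0) (𝓝 x) := by
    simpa using (hline 0).continuousAt.tendsto
  have hconv : ConvexOn ℝ Set.univ (fun s : ℝ => f (x + s • e)) := by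
    have h := hf.comp_affineMap (AffineMap.lineMap x (x + e) : ℝ →ᵃ[ℝ] E)
    simpa [Function.comp_def, AffineMap.lineMap_apply, add_comm] using h
  have hdiff : ∀ᶠ s in 𝓝 (0 : ℝ), DifferentiableAt ℝ f (x + s • e) :=
    htend.eventually ((hx.eventually (by simp)).mono fun y hy => hy.differentiableAt (by simp))
  have hderiv (s : ℝ) (hs : DifferentiableAt ℝ f (x + s • e)) :
      HasDerivAt (fun s : ℝ => f (x + s • e)) (fderiv ℝ f (x + s • e) e) s :=
    hs.hasFDerivAt.comp_hasDerivAt s (hline s)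
  have hsecond : HasDerivAt (fun s : ℝ => fderiv ℝ f (x + s • e) e)
      (fderiv ℝ (fderiv ℝ f) x e e) 0 := by
    have hd : DifferentiableAt ℝ (fderiv ℝ f) (x + (0 : ℝ) • e) := by
      simpa using (hx.fderiv_right (m := 1) (by norm_num)).differentiableAt (by simp)
    have h := (ContinuousLinearMap.apply ℝ ℝ e).hasFDerivAt.comp_hasDerivAt (0 : ℝ)
      (hd.hasFDerivAt.comp_hasDerivAt (0 : ℝ) (hline 0))
    rw [zero_smul, add_zero] at h
    exact h
  refine ge_of_tendsto hsecond.tendsto_slope_zero_right ?_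
  filter_upwards [self_mem_nhdsWithin, nhdsWithin_le_nhds hdiff] with s hs hds
  have hs : 0 < s := hs
  have hmono := (hconv.le_slope_of_hasDerivAt (Set.mem_univ 0) (Set.mem_univ s) hs
    (hderiv 0 hdiff.self_of_nhds)).trans
    (hconv.slope_le_of_hasDerivAt (Set.mem_univ 0) (Set.mem_univ s) hs (hderiv s hds))
  rw [zero_add]
  exact mul_nonneg (inv_nonneg.mpr hs.le) (sub_nonneg.mpr hmono)

theorem imPart_add_smul {n : ℕ} (z v : EuclideanSpace ℂ (Fin n)) (t : ℂ) :
    imPart (z + t • v) =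
      imPart z + (t.re • imPart v + t.im • imPart (Complex.I • v)) := by
  ext k
  simp [imPart]

/-- For every `z` with `Im z ≠ 0` and every `v`, the Laplacian at `t = 0` of
`t ↦ ‖Im (z + t • v)‖` is nonnegative: `z ↦ ‖Im z‖` is plurisubharmonic on `ℂ^n \ ℝ^n`. -/
theorem stmt2 {n : ℕ} (z : EuclideanSpace ℂ (Fin n)) (hy : imPart z ≠ 0)
    (v : EuclideanSpace ℂ (Fin n)) :
    0 ≤ lap (fun t : ℂ => ‖imPart (z + t • v)‖) 0 := by
  have hconv : ConvexOn ℝ Set.univ (fun t : ℂ => ‖imPart (z + t • v)‖) := by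
    simp only [imPart_add_smul]
    let L : ℂ →ₗ[ℝ] EuclideanSpace ℝ (Fin n) :=
      Complex.reLm.smulRight (imPart v) + Complex.imLm.smulRight (imPart (Complex.I • v))
    exact (convexOn_univ_norm (E := EuclideanSpace ℝ (Fin n))).comp_affineMap
      (AffineMap.const ℝ ℂ (imPart z) + L.toAffineMap)
  have hsmooth : ContDiffAt ℝ 2 (fun t : ℂ => ‖imPart (z + t • v)‖) 0 := by
    refine ContDiffAt.norm ℝ ?_ (by simpa using hy)
    simp only [imPart_add_smul]
    exact contDiffAt_const.add ((Complex.reCLM.contDiff.contDiffAt.smul contDiffAt_const).add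
      (Complex.imCLM.contDiff.contDiffAt.smul contDiffAt_const))
  exact add_nonneg (hconv.iteratedFDeriv_two_nonneg hsmooth 1)
    (hconv.iteratedFDeriv_two_nonneg hsmooth Complex.I)
end

section
/- Let ρ : ℂ^n → ℝ be a C² function with ρ ≥ 0 everywhere, and let K ⊆ ℂ^n be compact. Then there exists a constant A > 0 such that for every z ∈ K, the norm of the gradient (total derivative) of ρ at z satisfies ‖∇ρ(z)‖ ≤ A·√(ρ(z)). In particular, on the sublevel set {ρ ≤ s²} ∩ K one has ‖∇ρ‖ ≤ A·s. -/
/-- First-order Taylor bound for a function whose derivative is Lipschitz around `z`. -/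
theorem norm_taylor_remainder_le {E : Type*} [NormedAddCommGroup E] [NormedSpace ℝ E] {f : E → ℝ}
    (hf : Differentiable ℝ f) {z h : E} {C : ℝ} (hC : 0 ≤ C)
    (hL : ∀ w ∈ Metric.closedBall z ‖h‖, ‖fderiv ℝ f w - fderiv ℝ f z‖ ≤ C * ‖w - z‖) :
    ‖f (z + h) - f z - fderiv ℝ f z h‖ ≤ C * ‖h‖ ^ 2 := by
  have key := (convex_closedBall z ‖h‖).norm_image_sub_le_of_norm_fderiv_le' (𝕜 := ℝ) (f := f)
    (φ := fderiv ℝ f z) (C := C * ‖h‖) (x := z) (y := z + h)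
    (fun w _ => hf w)
    (fun w hw => (hL w hw).trans (mul_le_mul_of_nonneg_left (by simpa [dist_eq_norm] using hw) hC))
    (by simp) (by simp)
  simpa [pow_two, mul_assoc] using key

/-- A nonnegative function whose derivative is bounded by `C` at `z` and `C`-Lipschitz on the unit
ball around `z` has derivative at most `2 √C √(f z)` at `z`. -/
theorem norm_fderiv_le_sqrt_of_nonneg {E : Type*} [NormedAddCommGroup E] [NormedSpace ℝ E]
    {f : E → ℝ} (hf : Differentiable ℝ f) (hf0 : ∀ x, 0 ≤ f x) {z : E} {C : ℝ} (hC : 0 < C)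
    (hb : ‖fderiv ℝ f z‖ ≤ C)
    (hL : ∀ w ∈ Metric.closedBall z 1, ‖fderiv ℝ f w - fderiv ℝ f z‖ ≤ C * ‖w - z‖) :
    ‖fderiv ℝ f z‖ ≤ 2 * √C * √(f z) := by
  refine ContinuousLinearMap.opNorm_le_of_unit_norm (by positivity) fun v hv => ?_
  set a := fderiv ℝ f z v with ha
  have haC : |a| ≤ C := by
    simpa [hv] using (fderiv ℝ f z).le_of_opNorm_le hb v
  have hnorm : ‖(-(a / (2 * C))) • v‖ = |a| / (2 * C) := by
    rw [norm_smul, hv, mul_one, norm_neg, Real.norm_eq_abs, abs_div,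
      abs_of_pos (by positivity : 0 < 2 * C)]
  have hle : |a| / (2 * C) ≤ 1 := by
    rw [div_le_one (by positivity)]; linarith
  have key := norm_taylor_remainder_le hf (h := (-(a / (2 * C))) • v) hC.le
    (fun w hw => hL w (Metric.closedBall_subset_closedBall (hnorm.trans_le hle) hw))
  rw [hnorm, map_smul, ← ha, smul_eq_mul, Real.norm_eq_abs, div_pow, sq_abs] at key
  have h1 := (abs_le.mp key).2
  have h2 := hf0 (z + (-(a / (2 * C))) • v)
  have h3 : a ^ 2 / (4 * C) ≤ f z := by
    have e : a ^ 2 / (4 * C) = -(C * (a ^ 2 / (2 * C) ^ 2)) - -(a / (2 * C)) * a := by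
      field_simp; ring
    linarith
  rw [div_le_iff₀ (by positivity)] at h3
  rw [Real.norm_eq_abs]
  refine abs_le_of_sq_le_sq ?_ (by positivity)
  rw [mul_pow, mul_pow, Real.sq_sqrt hC.le, Real.sq_sqrt (hf0 z)]
  linarith

/-- On a compact set, the derivative of a nonnegative `C²` function is bounded by a multiple of the
square root of the function. -/
theorem exists_norm_fderiv_le_sqrt {E : Type*} [NormedAddCommGroup E] [NormedSpace ℝ E]
    [ProperSpace E] {f : E → ℝ} (hf : ContDiff ℝ 2 f) (hf0 : ∀ x, 0 ≤ f x) {K : Set E}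
    (hK : IsCompact K) : ∃ A > (0 : ℝ), ∀ z ∈ K, ‖fderiv ℝ f z‖ ≤ A * √(f z) := by
  have hf' : ContDiff ℝ 1 (fderiv ℝ f) := hf.fderiv_right (by norm_num)
  obtain ⟨R, hR⟩ := hK.isBounded.subset_closedBall 0
  obtain ⟨C₁, hC₁⟩ := hK.exists_bound_of_continuousOn hf'.continuous.continuousOn
  obtain ⟨C₂, hC₂⟩ := (isCompact_closedBall (0 : E) (R + 1)).exists_bound_of_continuousOn
    (hf'.continuous_fderiv (by norm_num)).continuousOn
  set C := max 1 (max C₁ C₂)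
  have hC : 0 < C := lt_max_of_lt_left one_pos
  have h₁ : C₁ ≤ C := (le_max_left _ _).trans (le_max_right _ _)
  have h₂ : C₂ ≤ C := (le_max_right _ _).trans (le_max_right _ _)
  refine ⟨2 * √C, by positivity, fun z hz => norm_fderiv_le_sqrt_of_nonneg
    (hf.differentiable (by norm_num)) hf0 hC ((hC₁ z hz).trans h₁) fun w hw => ?_⟩
  have hsub : Metric.closedBall z 1 ⊆ Metric.closedBall 0 (R + 1) :=
    Metric.closedBall_subset_closedBall' (by linarith [Metric.mem_closedBall.mp (hR hz)])
  exact (convex_closedBall z 1).norm_image_sub_le_of_norm_fderiv_le (𝕜 := ℝ)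
    (fun x _ => hf'.differentiable (by norm_num) x)
    (fun x hx => (hC₂ x (hsub hx)).trans h₂) (by simp) hw

/-- If `ρ : ℂ^n → ℝ` is `C²` and nonnegative, and `K` is compact, then there is `A > 0` with
`‖∇ρ(z)‖ ≤ A √(ρ z)` for all `z ∈ K`; in particular `‖∇ρ‖ ≤ A s` on `{ρ ≤ s²} ∩ K`. -/
theorem stmt6 {n : ℕ} (ρ : EuclideanSpace ℂ (Fin n) → ℝ)
    (hρ : ContDiff ℝ 2 ρ) (hρ0 : ∀ z, 0 ≤ ρ z)
    (K : Set (EuclideanSpace ℂ (Fin n))) (hK : IsCompact K) :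
    ∃ A > (0 : ℝ),
      (∀ z ∈ K, ‖fderiv ℝ ρ z‖ ≤ A * Real.sqrt (ρ z)) ∧
      (∀ s : ℝ, 0 ≤ s → ∀ z ∈ K, ρ z ≤ s ^ 2 → ‖fderiv ℝ ρ z‖ ≤ A * s) := by
  obtain ⟨A, hA, h⟩ := exists_norm_fderiv_le_sqrt hρ hρ0 hK
  refine ⟨A, hA, h, fun s hs z hz hzs => (h z hz).trans ?_⟩
  exact mul_le_mul_of_nonneg_left (Real.sqrt_le_iff.mpr ⟨hs, hzs⟩) hA.le
end

section
/- Let ρ : ℂ^n → ℝ be a smooth (C^∞) function with ρ ≥ 0, such that ρ(z) = 0 if and only if Im z = 0, and such that at every point x ∈ ℝ^n the Hessian of ρ at x is positive definite transverse to ℝ^n, i.e. D²ρ(x)(i·b, i·b) > 0 for every b ∈ ℝ^n, b ≠ 0. Then for every compact set K ⊆ ℝ^n there exist an open neighborhood V of K in ℂ^n and a constant c > 0 such that for every z ∈ V and every v ∈ ℂ^n, the Laplacian at t = 0 of the function t ↦ ρ(z + t·v) (t ranging over ℂ) is ≥ c·‖v‖². That is, ρ is strictly plurisubharmonic near ℝ^n.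 -/
open Complex

/-- The purely imaginary vector `i·b ∈ ℂ^n` with imaginary part `b ∈ ℝ^n`. -/
noncomputable def iVec {n : ℕ} (b : EuclideanSpace ℝ (Fin n)) : EuclideanSpace ℂ (Fin n) :=
  (WithLp.equiv 2 (Fin n → ℂ)).symm fun k => Complex.I * (b k)

/-- The vector in `ℂ^n` with real coordinates `a`. -/
noncomputable def realVec {n : ℕ} (a : EuclideanSpace ℝ (Fin n)) : EuclideanSpace ℂ (Fin n) :=
  WithLp.toLp 2 fun k => (a k : ℂ)

/-- The componentwise real part of a vector in `ℂ^n`. -/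
noncomputable def rePart {n : ℕ} (z : EuclideanSpace ℂ (Fin n)) : EuclideanSpace ℝ (Fin n) :=
  WithLp.toLp 2 fun k => (z k).re

lemma imPart_apply {n : ℕ} (z : EuclideanSpace ℂ (Fin n)) (k : Fin n) :
    imPart z k = (z k).im := rfl

lemma eq_realVec_add_iVec {n : ℕ} (v : EuclideanSpace ℂ (Fin n)) :
    v = realVec (rePart v) + iVec (imPart v) := by
  ext k
  apply Complex.ext <;> simp [realVec, rePart, imPart, iVec]

lemma I_smul_eq {n : ℕ} (v : EuclideanSpace ℂ (Fin n)) :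
    Complex.I • v = realVec (-imPart v) + iVec (rePart v) := by
  ext k
  apply Complex.ext <;> simp [realVec, rePart, imPart, iVec]

lemma imPart_add_smul_realVec {n : ℕ} {x : EuclideanSpace ℂ (Fin n)} (hx : imPart x = 0)
    (a : EuclideanSpace ℝ (Fin n)) (s : ℝ) : imPart (x + s • realVec a) = 0 := by
  ext k
  have h : (x k).im = 0 := by rw [← imPart_apply, hx]; rfl
  simp [imPart_apply, realVec, h]

/-- The Laplacian at `0` along a complex line is the trace of the Hessian on that line. -/
lemma lap_line_eq {E : Type*} [NormedAddCommGroup E] [NormedSpace ℂ E] {ρ : E → ℝ}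
    (hρ : ContDiff ℝ 2 ρ) (z v : E) :
    lap (fun t : ℂ => ρ (z + t • v)) 0 =
      fderiv ℝ (fderiv ℝ ρ) z v v
        + fderiv ℝ (fderiv ℝ ρ) z (Complex.I • v) (Complex.I • v) := by
  let L : ℂ →L[ℝ] E := (ContinuousLinearMap.toSpanSingleton ℂ v).restrictScalars ℝ
  have hf : (fun t : ℂ => ρ (z + t • v)) = (fun w => ρ (z + w)) ∘ L := rfl
  have hd : ContDiff ℝ 2 (fun w => ρ (z + w)) := by fun_prop
  rw [lap, hf, L.iteratedFDeriv_comp_right hd 0 le_rfl, iteratedFDeriv_comp_add_left]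
  simp [iteratedFDeriv_two_apply, L]

/-- The Hessian of `f` vanishes in a direction along which `f` keeps its minimum value `0`. -/
lemma fderiv_fderiv_apply_eq_zero {E : Type*} [NormedAddCommGroup E] [NormedSpace ℝ E]
    {f : E → ℝ} (hf : ContDiff ℝ 2 f) (hf0 : ∀ z, 0 ≤ f z) {x a : E}
    (h : ∀ s : ℝ, f (x + s • a) = 0) : fderiv ℝ (fderiv ℝ f) x a = 0 := by
  have hz (s : ℝ) : fderiv ℝ f (x + s • a) = 0 :=
    IsLocalMin.fderiv_eq_zero (Filter.Eventually.of_forall fun w => (h s).symm ▸ hf0 w)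
  have hd : DifferentiableAt ℝ (fderiv ℝ f) x :=
    (hf.fderiv_right (m := 1) (by norm_num)).differentiable (by norm_num) x
  have hl : HasLineDerivAt ℝ (fderiv ℝ f) (fderiv ℝ (fderiv ℝ f) x a) x a :=
    hd.hasFDerivAt.hasLineDerivAt a
  have hc : HasLineDerivAt ℝ (fderiv ℝ f) 0 x a := by
    simp only [HasLineDerivAt, hz]
    exact hasDerivAt_const _ _
  exact hl.unique hc

/-- A continuous family of quadratic functions, positive definite over a compact set `K`, is uniformly
positive definite near `K`. -/
lemma exists_isOpen_forall_le_of_pos {X E : Type*} [TopologicalSpace X] [NormedAddCommGroup E]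
    [NormedSpace ℝ E] [ProperSpace E] {Q : X → E → ℝ} (hQ : Continuous fun p : X × E => Q p.1 p.2)
    (hhom : ∀ z (r : ℝ) v, Q z (r • v) = r ^ 2 * Q z v) {K : Set X} (hK : IsCompact K)
    (hpos : ∀ z ∈ K, ∀ v ≠ 0, 0 < Q z v) :
    ∃ V : Set X, IsOpen V ∧ K ⊆ V ∧ ∃ c > (0 : ℝ), ∀ z ∈ V, ∀ v, c * ‖v‖ ^ 2 ≤ Q z v := by
  have hS := isCompact_sphere (0 : E) 1
  obtain ⟨m, hm, hmQ⟩ := (hK.prod hS).exists_forall_le' (a := 0) hQ.continuousOn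
    fun p hp => hpos _ hp.1 _ (ne_zero_of_mem_unit_sphere ⟨p.2, hp.2⟩)
  obtain ⟨V, W, hV, -, hKV, hSW, hVW⟩ := generalized_tube_lemma hK hS
    (isOpen_lt (continuous_const (y := m / 2)) hQ)
    fun p hp => (half_lt_self hm).trans_le (hmQ p hp)
  refine ⟨V, hV, hKV, m / 2, half_pos hm, fun z hz v => ?_⟩
  rcases eq_or_ne v 0 with rfl | hv
  · simpa using (hhom z 0 0).ge
  have hn : ‖v‖ ≠ 0 := norm_ne_zero_iff.2 hv
  have hu : ‖v‖⁻¹ • v ∈ Metric.sphere (0 : E) 1 := by simp [norm_smul, hn]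
  have hlt : m / 2 < Q z (‖v‖⁻¹ • v) := hVW (Set.mk_mem_prod hz (hSW hu))
  have hQv : Q z v = ‖v‖ ^ 2 * Q z (‖v‖⁻¹ • v) := by rw [← hhom, smul_inv_smul₀ hn]
  rw [hQv, mul_comm]
  gcongr

/-- At a real point the Hessian only sees the imaginary part of a vector. -/
lemma fderiv_fderiv_realVec_add_iVec {n : ℕ} {ρ : EuclideanSpace ℂ (Fin n) → ℝ}
    (hρ : ContDiff ℝ 2 ρ) (hρ0 : ∀ z, 0 ≤ ρ z) (hvanish : ∀ z, imPart z = 0 → ρ z = 0)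
    {x : EuclideanSpace ℂ (Fin n)} (hx : imPart x = 0) (a b : EuclideanSpace ℝ (Fin n)) :
    fderiv ℝ (fderiv ℝ ρ) x (realVec a + iVec b) (realVec a + iVec b) =
      iteratedFDeriv ℝ 2 ρ x ![iVec b, iVec b] := by
  have h0 : fderiv ℝ (fderiv ℝ ρ) x (realVec a) = 0 :=
    fderiv_fderiv_apply_eq_zero hρ hρ0 fun s => hvanish _ (imPart_add_smul_realVec hx a s)
  have hs : IsSymmSndFDerivAt ℝ ρ x := hρ.contDiffAt.isSymmSndFDerivAt (by simp)
  have hb : fderiv ℝ (fderiv ℝ ρ) x (iVec b) (realVec a) = 0 := by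
    rw [hs.eq, h0, zero_apply]
  simp [iteratedFDeriv_two_apply, h0, hb]

/-- If `ρ : ℂ^n → ℝ` is smooth, nonnegative, vanishes exactly on `ℝ^n`, with Hessian
positive definite transverse to `ℝ^n` at each point of `ℝ^n`, then `ρ` is strictly
plurisubharmonic near `ℝ^n`: near any compact `K ⊆ ℝ^n` there is `c > 0` such that the
Laplacian at `0` of `t ↦ ρ(z + t • v)` is at least `c‖v‖²`. -/
theorem stmt8 {n : ℕ} (ρ : EuclideanSpace ℂ (Fin n) → ℝ)
    (hρ : ContDiff ℝ (⊤ : ℕ∞) ρ) (hρ0 : ∀ z, 0 ≤ ρ z)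
    (hvanish : ∀ z, ρ z = 0 ↔ imPart z = 0)
    (hhess : ∀ x : EuclideanSpace ℂ (Fin n), imPart x = 0 →
      ∀ b : EuclideanSpace ℝ (Fin n), b ≠ 0 →
        0 < iteratedFDeriv ℝ 2 ρ x ![iVec b, iVec b])
    (K : Set (EuclideanSpace ℂ (Fin n))) (hK : IsCompact K)
    (hKreal : ∀ z ∈ K, imPart z = 0) :
    ∃ V : Set (EuclideanSpace ℂ (Fin n)), IsOpen V ∧ K ⊆ V ∧
      ∃ c > (0 : ℝ), ∀ z ∈ V, ∀ v : EuclideanSpace ℂ (Fin n),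
        c * ‖v‖ ^ 2 ≤ lap (fun t : ℂ => ρ (z + t • v)) 0 := by
  have h2 : ContDiff ℝ 2 ρ := hρ.of_le (WithTop.coe_le_coe.2 le_top)
  have hc : Continuous (fderiv ℝ (fderiv ℝ ρ)) :=
    (h2.fderiv_right (m := 1) (by norm_num)).continuous_fderiv (by norm_num)
  simp only [lap_line_eq h2]
  refine exists_isOpen_forall_le_of_pos
    (Q := fun z v => fderiv ℝ (fderiv ℝ ρ) z v v
      + fderiv ℝ (fderiv ℝ ρ) z (Complex.I • v) (Complex.I • v)) (by fun_prop) ?_ hK ?_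
  · intro z r v
    simp only [smul_comm Complex.I r v, map_smul, smul_eq_mul, smul_apply]
    ring
  · intro x hxK v hv
    have hx := hKreal x hxK
    have hH := fun a b => fderiv_fderiv_realVec_add_iVec h2 hρ0 (fun z => (hvanish z).2) hx a b
    have hnonneg (b : EuclideanSpace ℝ (Fin n)) :
        0 ≤ iteratedFDeriv ℝ 2 ρ x ![iVec b, iVec b] := by
      rcases eq_or_ne b 0 with rfl | hb
      · have : iVec (0 : EuclideanSpace ℝ (Fin n)) = 0 := by ext; simp [iVec]
        simp [iteratedFDeriv_two_apply, this]
      · exact (hhess x hx b hb).le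
    have hv1 : fderiv ℝ (fderiv ℝ ρ) x v v
        = iteratedFDeriv ℝ 2 ρ x ![iVec (imPart v), iVec (imPart v)] := by
      rw [← hH (rePart v) (imPart v), ← eq_realVec_add_iVec]
    rw [hv1, I_smul_eq, hH]
    by_cases hb : imPart v = 0
    · refine add_pos_of_nonneg_of_pos (hnonneg _) (hhess x hx _ fun ha => hv ?_)
      rw [eq_realVec_add_iVec v, ha, hb]
      ext
      simp [realVec, iVec]
    · exact add_pos_of_pos_of_nonneg (hhess x hx _ hb) (hnonneg _)
end

section
/- Let U ⊆ ℂ be open and f : U → ℂ^n holomorphic. Then for every t ∈ U with Im(f(t)) ≠ 0, the Laplacian at t of the function s ↦ ‖Im(f(s))‖ is ≥ 0. That is, ‖Im(·)‖ composed with a holomorphic map is subharmonic away from the preimage of ℝ^n. -/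
open Complex

open InnerProductSpace Laplacian Topology

/-- Second-order necessary condition for a local minimum on the real line. -/
theorem IsLocalMin.deriv_deriv_nonneg {g : ℝ → ℝ} {a : ℝ} (hmin : IsLocalMin g a)
    (hc : ContinuousAt g a) : 0 ≤ deriv (deriv g) a := by
  by_contra! hneg
  have hmax : IsLocalMax g a := isLocalMax_of_deriv_deriv_neg hneg hmin.deriv_eq_zero hc
  have hconst : g =ᶠ[𝓝 a] fun _ => g a := by
    filter_upwards [hmin, hmax] with x h₁ h₂ using le_antisymm h₂ h₁
  have hzero : deriv (deriv g) a = 0 := by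
    rw [hconst.deriv.deriv_eq]
    simp
  exact hneg.ne hzero

/-- Second-order necessary condition for a local minimum, in a given direction. -/
theorem IsLocalMin.iteratedFDeriv_two_nonneg {E : Type*} [NormedAddCommGroup E]
    [NormedSpace ℝ E] {g : E → ℝ} {a : E} (hmin : IsLocalMin g a) (hg : ContDiffAt ℝ 2 g a)
    (v : E) : 0 ≤ iteratedFDeriv ℝ 2 g a ![v, v] := by
  let γ : ℝ → E := fun r => a + r • v
  have hγ (r : ℝ) : HasDerivAt γ v r :=
    (((hasDerivAt_id r).smul_const v).const_add a).congr_deriv (one_smul ℝ v)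
  have hγ0 : γ 0 = a := by simp [γ]
  have hγt : Filter.Tendsto γ (𝓝 0) (𝓝 a) := by
    simpa [hγ0] using (hγ 0).continuousAt.tendsto
  have hdiff : ∀ᶠ x in 𝓝 a, DifferentiableAt ℝ g x :=
    (hg.eventually (by simp)).mono fun x hx => hx.differentiableAt (by simp)
  have hderiv : deriv (g ∘ γ) =ᶠ[𝓝 0] fun r => fderiv ℝ g (γ r) v := by
    filter_upwards [hγt.eventually hdiff] with r hr
    exact (hr.hasFDerivAt.comp_hasDerivAt r (hγ r)).deriv
  have hfd : HasFDerivAt (fderiv ℝ g) (fderiv ℝ (fderiv ℝ g) a) (γ 0) := by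
    rw [hγ0]
    exact ((hg.fderiv_right (m := 1) (by norm_num)).differentiableAt (by simp)).hasFDerivAt
  have hsnd : deriv (deriv (g ∘ γ)) 0 = fderiv ℝ (fderiv ℝ g) a v v := by
    rw [hderiv.deriv_eq]
    exact ((hfd.comp_hasDerivAt 0 (hγ 0)).clm_apply (hasDerivAt_const 0 v)).deriv.trans (by simp)
  have hloc : IsLocalMin (g ∘ γ) 0 := by
    have := hγt.eventually hmin
    simpa [IsLocalMin, IsMinFilter, hγ0] using this
  have hcont : ContinuousAt (g ∘ γ) 0 :=
    ContinuousAt.comp (by rw [hγ0]; exact hg.continuousAt) (hγ 0).continuousAt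
  rw [iteratedFDeriv_two_apply]
  simpa [hsnd] using hloc.deriv_deriv_nonneg hcont

/-- The Laplacian of a `C²` function on the plane is nonnegative at a local minimum. -/
theorem IsLocalMin.lap_nonneg {g : ℂ → ℝ} {t : ℂ} (hmin : IsLocalMin g t)
    (hg : ContDiffAt ℝ 2 g t) : 0 ≤ lap g t :=
  add_nonneg (hmin.iteratedFDeriv_two_nonneg hg 1) (hmin.iteratedFDeriv_two_nonneg hg Complex.I)

theorem lap_eq_laplacian (g : ℂ → ℝ) : lap g = Δ g :=
  (laplacian_eq_iteratedFDeriv_complexPlane g).symm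

/-- The norm of a harmonic vector-valued function has nonnegative Laplacian where it is nonzero:
it touches from above the harmonic function `s ↦ ⟪u t, u s⟫ / ‖u t‖`. -/
theorem InnerProductSpace.HarmonicAt.lap_norm_nonneg {F : Type*} [NormedAddCommGroup F]
    [InnerProductSpace ℝ F] {u : ℂ → F} {t : ℂ} (hu : HarmonicAt u t) (h0 : u t ≠ 0) :
    0 ≤ lap (fun s => ‖u s‖) t := by
  let l : F →L[ℝ] ℝ := innerSL ℝ (‖u t‖⁻¹ • u t)
  have hn : ‖u t‖ ≠ 0 := norm_ne_zero_iff.mpr h0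
  have hl : HarmonicAt (l ∘ u) t := hu.comp_CLM l
  have hnorm : ContDiffAt ℝ 2 (fun s => ‖u s‖) t := hu.1.norm ℝ h0
  have hle (s : ℂ) : l (u s) ≤ ‖u s‖ := by
    have := real_inner_le_norm (‖u t‖⁻¹ • u t) (u s)
    rwa [norm_smul, norm_inv, norm_norm, inv_mul_cancel₀ hn, one_mul] at this
  have heq : l (u t) = ‖u t‖ := by
    simp only [l, innerSL_apply_apply, real_inner_smul_left, real_inner_self_eq_norm_sq]
    field_simp
  have hmin : IsLocalMin ((fun s => ‖u s‖) - l ∘ u) t :=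
    Filter.Eventually.of_forall fun s => by simp [heq, hle s]
  have h := hmin.lap_nonneg (hnorm.sub hl.1)
  rwa [lap_eq_laplacian, hnorm.laplacian_sub hl.1, hl.2.eq_of_nhds, Pi.zero_apply, sub_zero,
    ← lap_eq_laplacian] at h

/-- The componentwise imaginary part as a continuous real-linear map. -/
noncomputable def imPartCLM (n : ℕ) : EuclideanSpace ℂ (Fin n) →L[ℝ] EuclideanSpace ℝ (Fin n) where
  toFun := imPart
  map_add' x y := by ext k; simp [imPart]
  map_smul' c x := by ext k; simp [imPart]
  cont := by
    unfold imPart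
    simp only [WithLp.equiv_symm_apply]
    fun_prop

/-- If `f : U → ℂ^n` is holomorphic on an open set `U ⊆ ℂ`, then at every `t ∈ U` with
`Im (f t) ≠ 0` the Laplacian of `s ↦ ‖Im (f s)‖` at `t` is nonnegative: `‖Im ·‖` composed
with a holomorphic map is subharmonic away from the preimage of `ℝ^n`. -/
theorem stmt11 {n : ℕ} (U : Set ℂ) (hU : IsOpen U)
    (f f' : ℂ → EuclideanSpace ℂ (Fin n))
    (hf : ∀ t ∈ U, HasDerivAt f (f' t) t) (t : ℂ) (ht : t ∈ U)
    (hIm : imPart (f t) ≠ 0) :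
    0 ≤ lap (fun s : ℂ => ‖imPart (f s)‖) t := by
  have han : AnalyticAt ℂ f t :=
    DifferentiableOn.analyticAt (fun s hs => (hf s hs).differentiableAt.differentiableWithinAt)
      (hU.mem_nhds ht)
  exact (han.harmonicAt.comp_CLM (imPartCLM n)).lap_norm_nonneg hIm
end
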